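/- Let F_q be a finite field with q elements. Then the number of matrices D ∈ GL₂(F_q) whose (−1)-eigenspace is one-dimensional, i.e. with dim ker(D + I) = 1, equals (q+1)(q²−q−1). -/

import Mathlib

open Module in
/-- A `2×2` matrix has one-dimensional kernel iff it is nonzero and singular. -/
theorem finrank_ker_mulVecLin_eq_one_iff {F : Type*} [Field F] (E : Matrix (Fin 2) (Fin 2) F) :
    finrank F (LinearMap.ker E.mulVecLin) = 1 ↔ E ≠ 0 ∧ E.det = 0 := by
  have hle : finrank F (LinearMap.ker E.mulVecLin) ≤ 2 := by
    simpa using Submodule.finrank_le (LinearMap.ker E.mulVecLin)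
  have h_zero : finrank F (LinearMap.ker E.mulVecLin) = 0 ↔ E.det ≠ 0 := by
    rw [Submodule.finrank_eq_zero, Matrix.ker_mulVecLin_eq_bot_iff, ← not_iff_not]
    push Not
    rw [← Matrix.exists_mulVec_eq_zero_iff]
    exact exists_congr fun v => and_comm
  have h_two : finrank F (LinearMap.ker E.mulVecLin) = 2 ↔ E = 0 := by
    constructor
    · intro h
      have h_top : LinearMap.ker E.mulVecLin = ⊤ :=
        Submodule.eq_top_of_finrank_eq (by simpa using h)
      rw [LinearMap.ker_eq_top] at h_top
      exact Matrix.toLin'.injective (by simpa [Matrix.toLin'_apply'] using h_top)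
    · rintro rfl
      rw [Matrix.mulVecLin_zero, LinearMap.ker_zero, finrank_top, finrank_fin_fun]
  rw [Ne, ← h_two, ← not_ne_iff (a := E.det), ← h_zero]
  omega

theorem isUnit_iff_trace_add_one_ne_one {F : Type*} [Field F] {D : Matrix (Fin 2) (Fin 2) F}
    (h : (D + 1).det = 0) : IsUnit D ↔ (D + 1).trace ≠ 1 := by
  rw [Matrix.isUnit_iff_isUnit_det, isUnit_iff_ne_zero, not_iff_not]
  simp only [Matrix.det_fin_two, Matrix.trace_fin_two, Matrix.add_apply, Matrix.one_apply_eq,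
    Matrix.one_apply_ne (zero_ne_one' (Fin 2)), Matrix.one_apply_ne (one_ne_zero' (Fin 2))]
    at h ⊢
  constructor <;> intro h_eq <;> linear_combination h - h_eq

/-- The singular matrix of trace `p.1` whose kernel contains `(1, 0)` for `none`
and `(-t, 1)` for `some t`. -/
def singularMatrix {F : Type*} [Field F] : Option F → F × F → Matrix (Fin 2) (Fin 2) F
  | none, p => !![0, p.2; 0, p.1]
  | some t, p => !![p.1 - t * p.2, t * (p.1 - t * p.2); p.2, t * p.2]

theorem det_singularMatrix {F : Type*} [Field F] (l : Option F) (p : F × F) :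
    (singularMatrix l p).det = 0 := by
  cases l
  · simp [singularMatrix, Matrix.det_fin_two]
  · simp only [singularMatrix, Matrix.det_fin_two_of]
    ring

theorem trace_singularMatrix {F : Type*} [Field F] (l : Option F) (p : F × F) :
    (singularMatrix l p).trace = p.1 := by
  cases l <;> simp [singularMatrix, Matrix.trace_fin_two]

theorem singularMatrix_eq_zero_iff {F : Type*} [Field F] (l : Option F) (p : F × F) :
    singularMatrix l p = 0 ↔ p = 0 := by
  obtain ⟨x, y⟩ := p
  cases l <;> simp [singularMatrix, ← Matrix.ext_iff, Fin.forall_fin_two] <;> grind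

theorem singularMatrix_injective {F : Type*} [Field F] {l l' : Option F} {p p' : F × F}
    (hp : p ≠ 0) (h : singularMatrix l p = singularMatrix l' p') : l = l' ∧ p = p' := by
  obtain ⟨x, y⟩ := p
  obtain ⟨x', y'⟩ := p'
  cases l <;> cases l' <;>
    simp [singularMatrix] at h hp ⊢ <;> grind

theorem exists_singularMatrix_eq {F : Type*} [Field F] {E : Matrix (Fin 2) (Fin 2) F}
    (h : E.det = 0) : ∃ l p, singularMatrix l p = E := by
  rw [Matrix.det_fin_two] at h
  rw [Matrix.eta_fin_two E]
  by_cases ha : E 0 0 = 0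
  · by_cases hc : E 1 0 = 0
    · exact ⟨none, (E 1 1, E 0 1), by simp [singularMatrix, ha, hc]⟩
    · refine ⟨some (E 1 1 / E 1 0), (E 1 1, E 1 0), ?_⟩
      have hb : E 0 1 = 0 := by grind
      simp [singularMatrix, ha, hb, hc]
  · refine ⟨some (E 0 1 / E 0 0), (E 0 0 + E 0 1 / E 0 0 * E 1 0, E 1 0), ?_⟩
    have hd : E 0 1 / E 0 0 * E 1 0 = E 1 1 := by
      field_simp
      linear_combination -h
    simp [singularMatrix, ha, hd]

theorem card_fst_ne_one_and_ne_zero (F : Type*) [Field F] [Fintype F] :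
    (Nat.card {p : F × F // p.1 ≠ 1 ∧ p ≠ 0} : ℤ) =
      (Fintype.card F : ℤ) ^ 2 - (Fintype.card F : ℤ) - 1 := by
  classical
  have h_eq : (Finset.univ.filter fun p : F × F => p.1 ≠ 1 ∧ p ≠ 0) =
      ((Finset.univ.erase (1 : F)) ×ˢ (Finset.univ : Finset F)).erase 0 := by
    ext p
    simp [and_comm]
  have h_pos : 1 < Fintype.card F := Fintype.one_lt_card
  rw [Nat.card_eq_fintype_card, Fintype.card_subtype, h_eq, Finset.card_erase_of_mem (by simp),
    Finset.card_product, Finset.card_erase_of_mem (Finset.mem_univ _), Finset.card_univ]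
  have h_mul : 1 ≤ (Fintype.card F - 1) * Fintype.card F :=
    Nat.mul_pos (by omega) (by omega)
  push_cast [h_mul, h_pos.le]
  ring

/-- Over a finite field with `q` elements, the number of
invertible `2×2` matrices `D` whose `(-1)`-eigenspace is one-dimensional,
i.e. with `dim ker(D + I) = 1`, equals `(q+1)(q²−q−1)`. -/
theorem stmt_18 (F : Type*) [Field F] [Fintype F] :
    (Nat.card {D : Matrix (Fin 2) (Fin 2) F //
        IsUnit D ∧ Module.finrank F (LinearMap.ker (D + 1).mulVecLin) = 1} : ℤ) =
      ((Fintype.card F : ℤ) + 1) * ((Fintype.card F : ℤ) ^ 2 - (Fintype.card F : ℤ) - 1) := by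
  have h_iff (D : Matrix (Fin 2) (Fin 2) F) :
      (IsUnit D ∧ Module.finrank F (LinearMap.ker (D + 1).mulVecLin) = 1) ↔
        (D + 1).trace ≠ 1 ∧ D + 1 ≠ 0 ∧ (D + 1).det = 0 := by
    rw [finrank_ker_mulVecLin_eq_one_iff]
    exact and_congr_left fun h => isUnit_iff_trace_add_one_ne_one h.2
  let f (x : Option F × {p : F × F // p.1 ≠ 1 ∧ p ≠ 0}) :
      {D : Matrix (Fin 2) (Fin 2) F //
        IsUnit D ∧ Module.finrank F (LinearMap.ker (D + 1).mulVecLin) = 1} :=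
    ⟨singularMatrix x.1 x.2 - 1, (h_iff _).2 <| by
      rw [sub_add_cancel, trace_singularMatrix, Ne, Ne, singularMatrix_eq_zero_iff]
      exact ⟨x.2.2.1, x.2.2.2, det_singularMatrix _ _⟩⟩
  have hf : Function.Bijective f := by
    constructor
    · rintro ⟨l, p, hp⟩ ⟨l', p', hp'⟩ h
      obtain ⟨rfl, rfl⟩ :=
        singularMatrix_injective hp.2 (sub_left_injective (congrArg Subtype.val h))
      rfl
    · rintro ⟨D, hD⟩
      obtain ⟨h_trace, h_ne, h_det⟩ := (h_iff D).1 hD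
      obtain ⟨l, p, h⟩ := exists_singularMatrix_eq h_det
      rw [← h, trace_singularMatrix] at h_trace
      rw [← h, Ne, singularMatrix_eq_zero_iff] at h_ne
      exact ⟨(l, ⟨p, h_trace, h_ne⟩), Subtype.ext (by simp [f, h])⟩
  rw [← Nat.card_eq_of_bijective f hf, Nat.card_prod, Nat.cast_mul, card_fst_ne_one_and_ne_zero,
    Finite.card_option, Nat.card_eq_fintype_card, Nat.cast_add_one]
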